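/- The volume of the subset of the unit (2n-1)-dimensional cube [0,1]^{2n-1} determined by the inequalities 1 ≥ x_{2i±1} ≥ x_{2i} ≥ 0 (i.e. each even-indexed coordinate is at most each of its odd-indexed neighbors) equals 2^{2n}(2^{2n}-1) B_{2n} / (2n)!, where B_{2n} is the (2n)-th Bernoulli number (taken in absolute value so the volume is positive). -/

import Mathlib

open MeasureTheory

/-- The region in `[0,1]^{2n-1}` where each even-position coordinate (1-based
indices 2,4,…,2n-2, i.e. zero-based odd indices) is ≤ both of its neighbors. -/
def cubeChainRegion (n : ℕ) : Set (Fin (2 * n - 1) → ℝ) :=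
  {x | (∀ k, x k ∈ Set.Icc (0 : ℝ) 1) ∧
    ∀ i : ℕ, (h : 2 * i + 2 < 2 * n - 1) →
      x ⟨2 * i + 1, by omega⟩ ≤ x ⟨2 * i, by omega⟩ ∧
      x ⟨2 * i + 1, by omega⟩ ≤ x ⟨2 * i + 2, by omega⟩}

namespace ZZ

open PowerSeries

noncomputable def Kc (u : ℝ) : PowerSeries ℝ :=
  PowerSeries.mk fun k => (u ^ k + (-u) ^ k) / (2 * (k.factorial : ℝ))
noncomputable def Sc (u : ℝ) : PowerSeries ℝ :=
  PowerSeries.mk fun k => (u ^ k - (-u) ^ k) / (2 * (k.factorial : ℝ))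
noncomputable def Cc : PowerSeries ℝ := (Kc 1)⁻¹

noncomputable def p (m : ℕ) (u : ℝ) : ℝ := coeff m (Cc * Sc u)
noncomputable def q (m : ℕ) (u : ℝ) : ℝ := coeff m (Cc * Kc u)

lemma Cc_mul : Cc * Kc 1 = 1 := by
  apply PowerSeries.inv_mul_cancel
  rw [← coeff_zero_eq_constantCoeff_apply]
  simp [Kc]

lemma p_zero (m : ℕ) : p m 0 = 0 := by
  have : Sc 0 = 0 := by ext k; simp [Sc]
  simp [p, this]

lemma q_one (m : ℕ) : q (m+1) 1 = 0 := by
  simp [q, Cc_mul, coeff_one]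

lemma q_zero (u : ℝ) : q 0 u = 1 := by
  simp [q, Cc, coeff_mul, Kc]

lemma deriv_aux (k : ℕ) (a : ℝ) (u : ℝ) :
    HasDerivAt (fun u : ℝ => (u ^ (k+1) + a * (-u) ^ (k+1)) / (2 * ((k+1).factorial : ℝ)))
      ((u ^ k - a * (-u) ^ k) / (2 * (k.factorial : ℝ))) u := by
  have h1 := (hasDerivAt_pow (k+1) u)
  have h2 := ((hasDerivAt_neg u).pow (k+1)).const_mul a
  have h3 := (h1.add h2).div_const (2 * ((k+1).factorial : ℝ))
  refine h3.congr_deriv ?_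
  have : ((k.factorial : ℝ)) ≠ 0 := by positivity
  rw [Nat.factorial_succ]
  push_cast
  have : (k:ℝ) + 1 ≠ 0 := by positivity
  try simp only [Nat.add_sub_cancel]
  field_simp
  ring

lemma p_deriv (m : ℕ) (u : ℝ) : HasDerivAt (p (m+1)) (q m u) u := by
  have : p (m+1) = fun u => ∑ x ∈ Finset.HasAntidiagonal.antidiagonal m, coeff x.1 Cc * coeff (x.2+1) (Sc u) := by
    funext u
    rw [p, coeff_mul, Finset.Nat.antidiagonal_succ']
    simp [Sc]
  rw [this, q, coeff_mul]
  apply HasDerivAt.fun_sum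
  intro x _
  apply HasDerivAt.const_mul
  have := deriv_aux x.2 (-1) u
  simpa [Sc, Kc, ← sub_eq_add_neg] using this

lemma q_deriv (m : ℕ) (u : ℝ) : HasDerivAt (q (m+1)) (p m u) u := by
  have : q (m+1) = fun u => coeff (m+1) Cc +
      ∑ x ∈ Finset.HasAntidiagonal.antidiagonal m, coeff x.1 Cc * coeff (x.2+1) (Kc u) := by
    funext u
    rw [q, coeff_mul, Finset.Nat.antidiagonal_succ']
    simp [Kc]
  rw [this, p, coeff_mul]
  apply HasDerivAt.const_add
  apply HasDerivAt.fun_sum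
  intro x _
  apply HasDerivAt.const_mul
  have := deriv_aux x.2 1 u
  simpa [Sc, Kc] using this

lemma p_cont (m : ℕ) : Continuous (p m) := by
  cases m with
  | zero => 
    have : p 0 = fun _ => 0 := by
      funext u
      simp [p, coeff_mul, Sc]
    rw [this]; exact continuous_const
  | succ m => exact continuous_iff_continuousAt.2 fun u => (p_deriv m u).continuousAt

lemma q_cont (m : ℕ) : Continuous (q m) := by
  cases m with
  | zero => 
    have : q 0 = fun _ => 1 := by
      funext u
      exact q_zero u
    rw [this]; exact continuous_const
  | succ m => exact continuous_iff_continuousAt.2 fun u => (q_deriv m u).continuousAt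

lemma int_q (m : ℕ) (t : ℝ) : ∫ s in t..1, q m (1 - s) = p (m+1) (1 - t) := by
  rw [intervalIntegral.integral_eq_sub_of_hasDerivAt (f := fun s => - p (m+1) (1 - s))]
  · simp [p_zero]
  · intro x _
    have := ((p_deriv m (1-x)).comp x ((hasDerivAt_id x).const_sub 1)).fun_neg
    simpa [Function.comp_def] using this
  · exact ((q_cont m).comp (continuous_const.sub continuous_id)).intervalIntegrable _ _

lemma int_p (m : ℕ) (t : ℝ) : ∫ s in (0:ℝ)..t, p m (1 - s) = - q (m+1) (1 - t) := by
  rw [intervalIntegral.integral_eq_sub_of_hasDerivAt (f := fun s => - q (m+1) (1 - s))]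
  · simp [q_one]
  · intro x _
    have := ((q_deriv m (1-x)).comp x ((hasDerivAt_id x).const_sub 1)).fun_neg
    simpa [Function.comp_def] using this
  · exact ((p_cont m).comp (continuous_const.sub continuous_id)).intervalIntegrable _ _

noncomputable def r (m : ℕ) (t : ℝ) : ℝ :=
  (-1) ^ (m / 2) * (if Odd m then p m (1 - t) else q m (1 - t))

lemma r_cont (m : ℕ) : Continuous (r m) := by
  unfold r
  have h1 := (p_cont m).comp (continuous_const.sub continuous_id : Continuous fun s : ℝ => 1 - s)
  have h2 := (q_cont m).comp (continuous_const.sub continuous_id : Continuous fun s : ℝ => 1 - s)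
  split_ifs
  · exact continuous_const.mul h1
  · exact continuous_const.mul h2

lemma r_zero (t : ℝ) : r 0 t = 1 := by simp [r, q_zero]

lemma r_odd (m : ℕ) (h : Odd (m+1)) (t : ℝ) : ∫ s in t..1, r m s = r (m+1) t := by
  have h' : ¬ Odd m := by grind
  have : (m+1)/2 = m/2 := by grind
  simp only [r, h, h', if_true, if_false, intervalIntegral.integral_const_mul, int_q, this]

lemma r_even (m : ℕ) (h : ¬ Odd (m+1)) (t : ℝ) : ∫ s in (0:ℝ)..t, r m s = r (m+1) t := by
  have h' : Odd m := by grind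
  have : (m+1)/2 = m/2 + 1 := by grind
  simp only [r, h, h', if_true, if_false, intervalIntegral.integral_const_mul, int_p, this]
  ring

def R : (m : ℕ) → ℝ → Set (Fin m → ℝ)
  | 0, _ => Set.univ
  | m+1, t => {x | x 0 ∈ (if Odd (m+1) then Set.Icc t 1 else Set.Icc 0 t) ∧
      (fun i : Fin m => x i.succ) ∈ R m (x 0)}

lemma R_meas (m : ℕ) : MeasurableSet {z : ℝ × (Fin m → ℝ) | z.2 ∈ R m z.1} := by
  induction m with
  | zero => simp [R]
  | succ m ih =>
    simp only [R, Set.mem_ofPred_eq]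
    refine MeasurableSet.inter (s₁ := {z : ℝ × (Fin (m+1) → ℝ) | z.2 0 ∈
        (if Odd (m+1) then Set.Icc z.1 1 else Set.Icc 0 z.1)})
      (s₂ := {z : ℝ × (Fin (m+1) → ℝ) | (fun i : Fin m => z.2 i.succ) ∈ R m (z.2 0)}) ?_ ?_
    · split_ifs
      · exact (measurableSet_le (f := fun z : ℝ × (Fin (m+1) → ℝ) => z.1)
          (g := fun z => z.2 0) (by fun_prop) (by fun_prop)).inter
          (measurableSet_le (f := fun z : ℝ × (Fin (m+1) → ℝ) => z.2 0)
          (g := fun z => 1) (by fun_prop) (by fun_prop))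
      · exact (measurableSet_le (f := fun z : ℝ × (Fin (m+1) → ℝ) => 0)
          (g := fun z => z.2 0) (by fun_prop) (by fun_prop)).inter
          (measurableSet_le (f := fun z : ℝ × (Fin (m+1) → ℝ) => z.2 0)
          (g := fun z => z.1) (by fun_prop) (by fun_prop))
    · have : Measurable (fun z : ℝ × (Fin (m+1) → ℝ) => (z.2 0, fun i : Fin m => z.2 i.succ)) := by
        fun_prop
      exact this ih

lemma R_vol_succ (m : ℕ) (t : ℝ) : volume (R (m+1) t) =
    ∫⁻ s in (if Odd (m+1) then Set.Icc t 1 else Set.Icc 0 t), volume (R m s) := by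
  set I := (if Odd (m+1) then Set.Icc t 1 else Set.Icc 0 t) with hI
  have hIm : MeasurableSet I := by rw [hI]; split_ifs <;> exact measurableSet_Icc
  have hp := volume_preserving_piFinSuccAbove (fun _ : Fin (m+1) => ℝ) 0
  let A : Set (ℝ × (Fin m → ℝ)) := {z | z.1 ∈ I ∧ z.2 ∈ R m z.1}
  have hA : MeasurableSet A := (measurable_fst hIm).inter (R_meas m)
  have e : R (m+1) t = (MeasurableEquiv.piFinSuccAbove (fun _ : Fin (m+1) => ℝ) 0) ⁻¹' A := by
    ext x
    simp [R, A, MeasurableEquiv.piFinSuccAbove, hI, Fin.insertNthEquiv]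
    exact fun _ => Iff.rfl
  rw [e, hp.measure_preimage hA.nullMeasurableSet, Measure.volume_eq_prod,
    Measure.prod_apply hA, ← lintegral_indicator hIm]
  congr 1
  funext s
  by_cases hs : s ∈ I
  · simp [hs, A, Set.preimage]
  · simp [hs, A, Set.preimage]

lemma step (m : ℕ) (a b : ℝ) (ha : 0 ≤ a) (hb : b ≤ 1) (hab : a ≤ b)
    (ih : ∀ t ∈ Set.Icc (0:ℝ) 1, 0 ≤ r m t ∧ volume (R m t) = ENNReal.ofReal (r m t)) :
    0 ≤ ∫ s in a..b, r m s ∧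
    ∫⁻ s in Set.Icc a b, volume (R m s) = ENNReal.ofReal (∫ s in a..b, r m s) := by
  have hs : ∀ s ∈ Set.Icc a b, s ∈ Set.Icc (0:ℝ) 1 := fun s hs => ⟨ha.trans hs.1, hs.2.trans hb⟩
  refine ⟨intervalIntegral.integral_nonneg hab fun s h => (ih s (hs s h)).1, ?_⟩
  rw [setLIntegral_congr_fun measurableSet_Icc (fun s h => (ih s (hs s h)).2),
    intervalIntegral.integral_of_le hab, ← integral_Icc_eq_integral_Ioc,
    ofReal_integral_eq_lintegral_ofReal]
  · exact (r_cont m).continuousOn.integrableOn_Icc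
  · exact (ae_restrict_iff' measurableSet_Icc).2 (.of_forall fun s h => (ih s (hs s h)).1)

lemma R_vol (m : ℕ) : ∀ t ∈ Set.Icc (0:ℝ) 1,
    0 ≤ r m t ∧ volume (R m t) = ENNReal.ofReal (r m t) := by
  induction m with
  | zero => 
    intro t _
    refine ⟨by simp [r_zero], ?_⟩
    rw [r_zero, ENNReal.ofReal_one, R, volume_pi, Measure.pi_of_empty]
    simp
  | succ m ih =>
    intro t ht
    rw [R_vol_succ]
    by_cases h : Odd (m+1)
    · rw [if_pos h, ← r_odd m h t]
      exact step m t 1 ht.1 le_rfl ht.2 ih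
    · rw [if_neg h, ← r_even m h t]
      exact step m 0 t le_rfl ht.2 ht.1 ih

lemma mem_R (m : ℕ) : ∀ t ∈ Set.Icc (0:ℝ) 1, ∀ x : Fin m → ℝ, x ∈ R m t ↔
    (∀ k, x k ∈ Set.Icc (0:ℝ) 1) ∧
    (∀ h : 0 < m, if Odd m then t ≤ x ⟨0, h⟩ else x ⟨0, h⟩ ≤ t) ∧
    (∀ i, ∀ h : i + 1 < m, if Odd (m - (i + 1)) then x ⟨i, by omega⟩ ≤ x ⟨i+1, h⟩ else
      x ⟨i+1, h⟩ ≤ x ⟨i, by omega⟩) := by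
  induction m with
  | zero => intro t _ x; simp [R]
  | succ m ih =>
    intro t ht x
    have h0 : x ∈ R (m+1) t ↔ x 0 ∈ Set.Icc (0:ℝ) 1 ∧ (if Odd (m+1) then t ≤ x 0 else x 0 ≤ t) ∧
        (fun i : Fin m => x i.succ) ∈ R m (x 0) := by
      simp only [R, Set.mem_ofPred_eq]
      split_ifs
      · simp only [Set.mem_Icc] at *
        constructor
        · rintro ⟨⟨a, b⟩, c⟩; exact ⟨⟨ht.1.trans a, b⟩, a, c⟩
        · rintro ⟨⟨a, b⟩, c, d⟩; exact ⟨⟨c, b⟩, d⟩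
      · simp only [Set.mem_Icc] at *
        constructor
        · rintro ⟨⟨a, b⟩, c⟩; exact ⟨⟨a, b.trans ht.2⟩, b, c⟩
        · rintro ⟨⟨a, b⟩, c, d⟩; exact ⟨⟨a, c⟩, d⟩
    rw [h0]
    constructor
    · rintro ⟨a, b, c⟩
      obtain ⟨c1, c2, c3⟩ := (ih _ a _).1 c
      refine ⟨Fin.cases a c1, fun _ => b, ?_⟩
      rintro (_ | i) h
      · have := c2 (by omega)
        simpa only [Nat.add_sub_cancel, zero_add, Fin.succ_mk, Fin.mk_zero, Fin.zero_eta] using this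
      · have := c3 i (by omega)
        simpa using this
    · rintro ⟨a, b, c⟩
      refine ⟨a 0, b (by omega), (ih _ (a 0) _).2 ⟨fun k => a k.succ, fun h => ?_, fun i h => ?_⟩⟩
      · simpa using c 0 (by omega)
      · simpa using c (i+1) (by omega)

/- power series -/
lemma tan_series : X * (Cc * Sc 1) = rescale (4:ℝ) (bernoulliPowerSeries ℝ)
    - rescale (2:ℝ) (bernoulliPowerSeries ℝ) + X := by
  set B := bernoulliPowerSeries ℝ
  set E := PowerSeries.exp ℝ
  set F := rescale (-1:ℝ) E
  have hB : B * (E - 1) = X := bernoulliPowerSeries_mul_exp_sub_one ℝ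
  have hEF : E * F = 1 := exp_mul_exp_neg_eq_one
  have hE2 : rescale (2:ℝ) E = E ^ 2 := by
    have := exp_pow_eq_rescale_exp (A := ℝ) 2
    simpa using this.symm
  have hE4 : rescale (4:ℝ) E = E ^ 4 := by
    have := exp_pow_eq_rescale_exp (A := ℝ) 4
    simpa using this.symm
  have h2 : rescale (2:ℝ) B * (E ^ 2 - 1) = 2 * X := by
    have := congrArg (rescale (2:ℝ)) hB
    simpa [hE2, rescale_X, show C (2:ℝ) = 2 from map_ofNat C 2] using this
  have h4 : rescale (4:ℝ) B * (E ^ 4 - 1) = 4 * X := by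
    have := congrArg (rescale (4:ℝ)) hB
    simpa [hE4, rescale_X, show C (4:ℝ) = 4 from map_ofNat C 4] using this
  have hK : 2 * Kc 1 = E + F := by
    ext k
    rw [show (2 : PowerSeries ℝ) = C (2:ℝ) from (map_ofNat C 2).symm, coeff_C_mul]
    simp [Kc, E, F, coeff_rescale, coeff_exp]
    field_simp
  have hS : 2 * Sc 1 = E - F := by
    ext k
    rw [show (2 : PowerSeries ℝ) = C (2:ℝ) from (map_ofNat C 2).symm, coeff_C_mul]
    simp [Sc, E, F, coeff_rescale, coeff_exp]
    field_simp
  set B2 := rescale (2:ℝ) B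
  set B4 := rescale (4:ℝ) B
  have hne : (E^2 - 1) ≠ 0 := by
    intro h
    rw [h] at h2
    have := congrArg (coeff 1) h2
    rw [show (2 : PowerSeries ℝ) = C (2:ℝ) from (map_ofNat C 2).symm, coeff_C_mul] at this
    simp at this
  have h2ne : (2 : PowerSeries ℝ) ≠ 0 := by
    intro h
    have := congrArg (coeff 0) h
    rw [show (2 : PowerSeries ℝ) = C (2:ℝ) from (map_ofNat C 2).symm] at this
    simp at this
  have hEne : E ≠ 0 := left_ne_zero_of_mul_eq_one hEF
  have key : (B4 - B2 + X) * (E^2+1) = X * (E^2 - 1) := by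
    apply mul_right_cancel₀ hne
    linear_combination h4 - (E^2+1) * h2
  have key2 : (B4 - B2 + X) * (2 * Kc 1) = X * (2 * Sc 1) := by
    apply mul_left_cancel₀ hEne
    rw [hK, hS]
    linear_combination key + (B4 - B2 + X) * hEF + X * hEF
  have key3 : (B4 - B2 + X) * Kc 1 = X * Sc 1 := by
    apply mul_left_cancel₀ h2ne
    linear_combination key2
  linear_combination (-Cc) * key3 + (B4 - B2 + X) * Cc_mul

lemma p_val (n : ℕ) (hn : 1 ≤ n) : p (2*n-1) 1 =
    (2 : ℝ) ^ (2 * n) * ((2 : ℝ) ^ (2 * n) - 1) * ((bernoulli (2 * n) : ℚ) : ℝ) /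
        (Nat.factorial (2 * n)) := by
  have := congrArg (coeff (2*n-1+1)) tan_series
  rw [coeff_succ_X_mul] at this
  rw [p, this, show 2*n-1+1 = 2*n by omega]
  simp [bernoulliPowerSeries, coeff_rescale, coeff_X, show 2*n ≠ 1 by omega]
  rw [show (4:ℝ) = 2*2 by norm_num, mul_pow]
  field_simp

end ZZ

theorem stmt_1 (n : ℕ) (hn : 1 ≤ n) :
    (volume (cubeChainRegion n)).toReal =
      |(2 : ℝ) ^ (2 * n) * ((2 : ℝ) ^ (2 * n) - 1) * ((bernoulli (2 * n) : ℚ) : ℝ)| /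
        (Nat.factorial (2 * n)) := by
  have hodd : Odd (2*n-1) := by grind
  have hR : cubeChainRegion n = ZZ.R (2*n-1) 0 := by
    ext x
    rw [ZZ.mem_R _ 0 ⟨le_rfl, zero_le_one⟩, cubeChainRegion, Set.mem_ofPred_eq]
    refine and_congr_right fun hx => ?_
    constructor
    · intro H
      refine ⟨fun h => by rw [if_pos hodd]; exact (hx _).1, fun i h => ?_⟩
      split_ifs with ho
      · obtain ⟨j, rfl⟩ : ∃ j, i = 2 * j + 1 := ⟨i / 2, by grind⟩
        exact (H j (by omega)).2
      · obtain ⟨j, rfl⟩ : ∃ j, i = 2 * j := ⟨i / 2, by grind⟩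
        exact (H j (by grind)).1
    · rintro ⟨-, H⟩ i h
      have h1 := H (2*i) (by omega)
      have h2 := H (2*i+1) (by omega)
      rw [if_neg (by grind)] at h1
      rw [if_pos (by grind)] at h2
      exact ⟨h1, h2⟩
  obtain ⟨h0, hv⟩ := ZZ.R_vol (2*n-1) 0 ⟨le_rfl, zero_le_one⟩
  rw [hR, hv, ENNReal.toReal_ofReal h0, ← abs_of_nonneg h0, ZZ.r, if_pos hodd, abs_mul, abs_pow,
    abs_neg, abs_one, one_pow, one_mul, sub_zero, ZZ.p_val n hn, abs_div, Nat.abs_cast]
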